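/- Assume additionally that α·(|a|+δ)^{(1/p)−1} < 1, that à := −log₂(α)/s and B̃ := log₂(|a|+δ)/s are positive integers that are relatively prime, and that a²·(1−p + p/K²) < 1 together with p·α²/(1 − (1−p)(|a|+δ)²) < 1. Then every invariant probability measure π of the Markov kernel P of the pair process (x_t, Δ_t) on ℝ × D has a finite second moment in the first coordinate: ∫ x² π(d(x,Δ)) < ∞. -/

import Mathlib

open MeasureTheory ProbabilityTheory ENNReal

/-- The uniform quantizer `Q_K^Δ` with `K` bins of size `Δ` in the granular region
`[-(K/2)Δ, (K/2)Δ]` (here `2^{R'-1} = K/2`). -/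
noncomputable def Qq (K : ℕ) (Δ x : ℝ) : ℝ :=
  if x = (K : ℝ) / 2 * Δ then ((K : ℝ) - 1) / 2 * Δ
  else if |x| ≤ (K : ℝ) / 2 * Δ then
    ((⌊x / Δ + (K : ℝ) / 2⌋ : ℝ) + 1 - ((K : ℝ) + 1) / 2) * Δ
  else 0

/-- The adaptive-quantizer zoom factor `H(Δ, h, υ)`. -/
noncomputable def Hf (a δ α L Δ h : ℝ) (υ : Bool) : ℝ :=
  if 1 < |h| ∨ υ = false then |a| + δ
  else if L ≤ Δ then α else 1

/-- The countable set of admissible bin sizes: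
`D = {Δ ≥ L' = αL : log₂ Δ is an integer multiple of s}`. -/
def Dset (α L s : ℝ) : Set ℝ :=
  {Δ : ℝ | α * L ≤ Δ ∧ ∃ z : ℤ, Real.logb 2 Δ = (z : ℝ) * s}

/-- A stationary law of a Markov kernel that contracts a finite Lyapunov function up to an additive
constant integrates that function. -/
theorem lintegral_lt_top_of_geometric_drift {X : Type*} [MeasurableSpace X]
    (P : Kernel X X) [IsMarkovKernel P] (π : Measure X) [IsProbabilityMeasure π]
    (hπ : ∀ A : Set X, MeasurableSet A → ∫⁻ z, P z A ∂π = π A)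
    {V : X → ℝ≥0∞} (hV : Measurable V) (hVtop : ∀ z, V z ≠ ⊤)
    {r b : ℝ≥0∞} (hr : r < 1) (hb : b ≠ ⊤)
    (hdrift : ∀ z, ∫⁻ w, V w ∂(P z) ≤ r * V z + b) :
    ∫⁻ z, V z ∂π < ⊤ := by
  have hbind : π.bind P = π := by
    ext A hA
    rw [Measure.bind_apply hA P.measurable.aemeasurable, hπ A hA]
  have hinv : ∀ f : X → ℝ≥0∞, Measurable f → ∫⁻ z, ∫⁻ w, f w ∂(P z) ∂π = ∫⁻ z, f z ∂π := by
    intro f hf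
    conv_rhs => rw [← hbind]
    rw [Measure.lintegral_bind P.measurable.aemeasurable hf.aemeasurable]
  have hmin : ∀ (k n : ℕ), Measurable fun z => min (r ^ k * V z) (n : ℝ≥0∞) := fun k n =>
    (hV.const_mul _).min measurable_const
  have hiter : ∀ n k : ℕ, ∫⁻ z, min (V z) (n : ℝ≥0∞) ∂π
      ≤ ∫⁻ z, min (r ^ k * V z) (n : ℝ≥0∞) ∂π + ∑ i ∈ Finset.range k, r ^ i * b := by
    intro n k
    induction k with
    | zero => simp
    | succ k ih =>
      refine ih.trans ?_
      rw [Finset.sum_range_succ, add_comm (∑ i ∈ Finset.range k, r ^ i * b), ← add_assoc]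
      gcongr
      rw [← hinv _ (hmin k n)]
      calc ∫⁻ z, ∫⁻ w, min (r ^ k * V w) (n : ℝ≥0∞) ∂(P z) ∂π
          ≤ ∫⁻ z, (min (r ^ (k + 1) * V z) (n : ℝ≥0∞) + r ^ k * b) ∂π := by
            refine lintegral_mono fun z => ?_
            have h1 : ∫⁻ w, min (r ^ k * V w) (n : ℝ≥0∞) ∂(P z)
                ≤ r ^ (k + 1) * V z + r ^ k * b := by
              calc _ ≤ ∫⁻ w, r ^ k * V w ∂(P z) := lintegral_mono fun w => min_le_left _ _
                _ = r ^ k * ∫⁻ w, V w ∂(P z) := lintegral_const_mul _ hV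
                _ ≤ r ^ k * (r * V z + b) := by gcongr; exact hdrift z
                _ = _ := by ring
            have h2 : ∫⁻ w, min (r ^ k * V w) (n : ℝ≥0∞) ∂(P z) ≤ n := by
              calc _ ≤ ∫⁻ w, (n : ℝ≥0∞) ∂(P z) := lintegral_mono fun w => min_le_right _ _
                _ = n := by simp
            rw [min_add]
            exact le_min h1 (h2.trans le_self_add)
        _ = _ := by
            rw [lintegral_add_left (hmin (k + 1) n)]
            simp
  have hgeom : ∀ k : ℕ, ∑ i ∈ Finset.range k, r ^ i * b ≤ (1 - r)⁻¹ * b := by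
    intro k
    rw [← Finset.sum_mul, ← ENNReal.tsum_geometric]
    gcongr
    exact ENNReal.sum_le_tsum _
  have hbound : ∀ n : ℕ, ∫⁻ z, min (V z) (n : ℝ≥0∞) ∂π ≤ (1 - r)⁻¹ * b := by
    intro n
    have hlim : Filter.Tendsto (fun k : ℕ => ∫⁻ z, min (r ^ k * V z) (n : ℝ≥0∞) ∂π)
        Filter.atTop (nhds (∫⁻ _, 0 ∂π)) := by
      refine tendsto_lintegral_of_dominated_convergence (fun _ => (n : ℝ≥0∞))
        (fun k => hmin k n) (fun k => Filter.Eventually.of_forall fun z => min_le_right _ _)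
        (by simp) (Filter.Eventually.of_forall fun z => ?_)
      have h := ENNReal.Tendsto.mul_const (b := V z)
        (ENNReal.tendsto_pow_atTop_nhds_zero_of_lt_one hr) (Or.inr (hVtop z))
      rw [zero_mul] at h
      exact tendsto_of_tendsto_of_tendsto_of_le_of_le tendsto_const_nhds h
        (fun _ => zero_le) (fun _ => min_le_left _ _)
    have hlim' := hlim.add_const ((1 - r)⁻¹ * b)
    rw [lintegral_zero, zero_add] at hlim'
    exact ge_of_tendsto' hlim' fun k => (hiter n k).trans (by gcongr; exact hgeom k)
  have hsup : ∫⁻ z, V z ∂π = ⨆ n : ℕ, ∫⁻ z, min (V z) (n : ℝ≥0∞) ∂π := by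
    rw [← lintegral_iSup (fun n => hV.min measurable_const)
      (fun i j hij z => min_le_min_left _ (by exact_mod_cast hij))]
    refine lintegral_congr fun z => ?_
    refine le_antisymm ?_ (iSup_le fun n => min_le_left _ _)
    obtain ⟨n, hn⟩ := ENNReal.exists_nat_gt (hVtop z)
    exact le_iSup_of_le n (le_min le_rfl hn.le)
  rw [hsup]
  refine lt_of_le_of_lt (iSup_le hbound) (ENNReal.mul_lt_top ?_ hb.lt_top)
  exact ENNReal.inv_lt_top.2 (tsub_pos_of_lt hr)

theorem abs_sub_Qq_le {K : ℕ} {Δ x : ℝ} (hΔ : 0 < Δ) (hx : |x| ≤ (K : ℝ) / 2 * Δ) :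
    |x - Qq K Δ x| ≤ Δ / 2 := by
  unfold Qq
  rw [if_pos hx]
  split_ifs with h
  · rw [h, show (K : ℝ) / 2 * Δ - ((K : ℝ) - 1) / 2 * Δ = Δ / 2 by ring, abs_of_pos (by positivity)]
  · have h1 := Int.floor_le (x / Δ + (K : ℝ) / 2)
    have h2 := Int.lt_floor_add_one (x / Δ + (K : ℝ) / 2)
    set f : ℝ := (⌊x / Δ + (K : ℝ) / 2⌋ : ℝ)
    have hxe : x = x / Δ * Δ := by field_simp
    rw [show x - (f + 1 - ((K : ℝ) + 1) / 2) * Δ = (x / Δ + K / 2 - f - 1 / 2) * Δ by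
      field_simp; ring, abs_mul, abs_of_pos hΔ, show Δ / 2 = 1 / 2 * Δ by ring]
    gcongr
    rw [abs_le]
    constructor <;> linarith

theorem Qq_eq_zero {K : ℕ} {Δ x : ℝ} (hΔ : 0 ≤ Δ) (hx : (K : ℝ) / 2 * Δ < |x|) :
    Qq K Δ x = 0 := by
  unfold Qq
  rw [if_neg, if_neg hx.not_ge]
  intro h
  rw [h, abs_of_nonneg (by positivity)] at hx
  exact hx.false

/-- The Lyapunov function `Δ² (1 + M |h|^m)` with `h = x / (c Δ)`. -/
noncomputable def zoomLyapunov (c M : ℝ) (m : ℕ) (x Δ : ℝ) : ℝ :=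
  Δ ^ 2 * (1 + M * (|x| / (c * Δ)) ^ m)

theorem zoomLyapunov_add_le {c M θ q r u d Δ : ℝ} {m : ℕ} (hm : 2 ≤ m) (hc : 1 ≤ c) (hM : 0 ≤ M)
    (hθ0 : 0 < θ) (hθ1 : θ < 1) (hq : 0 ≤ q) (hr : 0 ≤ r) (hΔ : 1 ≤ Δ)
    (hu : |u| ≤ θ * q * r * (c * Δ)) :
    zoomLyapunov c M m (u + d) Δ
      ≤ Δ ^ 2 * (1 + M * (q * r) ^ m) + M * (|d| / (1 - θ)) ^ m := by
  have h1θ : 0 < 1 - θ := by linarith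
  have hcΔ : 0 < c * Δ := by positivity
  have hcΔ1 : Δ ≤ c * Δ := le_mul_of_one_le_left (by linarith) hc
  have hy0 : 0 ≤ |d| / (1 - θ) := by positivity
  have hle : |u + d| / (c * Δ) ≤ max (q * r) (|d| / (1 - θ) / Δ) := by
    rw [div_le_iff₀ hcΔ]
    have hA : q * r * (c * Δ) ≤ max (q * r) (|d| / (1 - θ) / Δ) * (c * Δ) := by
      gcongr; exact le_max_left _ _
    have hB : |d| / (1 - θ) ≤ max (q * r) (|d| / (1 - θ) / Δ) * (c * Δ) := by
      calc |d| / (1 - θ) = |d| / (1 - θ) / Δ * Δ := by field_simp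
        _ ≤ _ := by gcongr; exact le_max_right _ _
    rw [div_le_iff₀ h1θ] at hB
    have := abs_add_le u d
    nlinarith
  have hpow : (|u + d| / (c * Δ)) ^ m ≤ (q * r) ^ m + (|d| / (1 - θ) / Δ) ^ m := by
    refine (pow_le_pow_left₀ (by positivity) hle m).trans ?_
    rcases max_cases (q * r) (|d| / (1 - θ) / Δ) with h | h <;> rw [h.1]
    · have : 0 ≤ (|d| / (1 - θ) / Δ) ^ m := by positivity
      linarith
    · have : 0 ≤ (q * r) ^ m := by positivity
      linarith
  have hnoise : Δ ^ 2 * (|d| / (1 - θ) / Δ) ^ m ≤ (|d| / (1 - θ)) ^ m := by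
    rw [div_pow _ Δ, mul_div_assoc', div_le_iff₀ (by positivity), mul_comm]
    gcongr
  unfold zoomLyapunov
  calc Δ ^ 2 * (1 + M * (|u + d| / (c * Δ)) ^ m)
      ≤ Δ ^ 2 * (1 + M * ((q * r) ^ m + (|d| / (1 - θ) / Δ) ^ m)) := by gcongr
    _ = Δ ^ 2 * (1 + M * (q * r) ^ m) + M * (Δ ^ 2 * (|d| / (1 - θ) / Δ) ^ m) := by ring
    _ ≤ _ := by gcongr

theorem sq_le_zoomLyapunov {c M x Δ : ℝ} {m : ℕ} (hm : 2 ≤ m) (hc : 0 < c) (hM : 1 ≤ M)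
    (hΔ : 0 < Δ) : x ^ 2 ≤ c ^ 2 * zoomLyapunov c M m x Δ := by
  set h := |x| / (c * Δ) with hh
  have hx : x ^ 2 = c ^ 2 * (Δ ^ 2 * h ^ 2) := by
    rw [hh, div_pow, sq_abs]; field_simp
  have h0 : 0 ≤ h := by positivity
  have hpow : h ^ 2 ≤ 1 + M * h ^ m := by
    have hhm : h ^ m ≤ M * h ^ m := le_mul_of_one_le_left (by positivity) hM
    rcases le_total h 1 with h1 | h1
    · have : h ^ 2 ≤ 1 := pow_le_one₀ h0 h1
      have : 0 ≤ h ^ m := by positivity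
      linarith
    · have := pow_le_pow_right₀ h1 hm
      linarith
  rw [hx]
  unfold zoomLyapunov
  gcongr

theorem measurable_zoomLyapunov (c M : ℝ) (m : ℕ) :
    Measurable fun w : ℝ × ℝ => zoomLyapunov c M m w.1 w.2 := by
  unfold zoomLyapunov
  fun_prop

theorem lintegral_abs_pow_gaussianReal_ne_top (μ : ℝ) (v : NNReal) (M t : ℝ) (m : ℕ) :
    ∫⁻ d, ENNReal.ofReal (M * (|d| / t) ^ m) ∂(gaussianReal μ v) ≠ ⊤ := by
  have h : Integrable (fun d : ℝ => M * (|d| / t) ^ m) (gaussianReal μ v) := by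
    have h1 := (memLp_id_gaussianReal' (μ := μ) (v := v) (m : ℝ≥0∞) (by simp)).integrable_norm_pow'
    simp only [div_pow, id, Real.norm_eq_abs] at h1 ⊢
    exact (h1.div_const _).const_mul _
  exact (lt_of_le_of_lt (lintegral_mono fun d => Real.ofReal_le_enorm _) h.2).ne

/-- Drift inequality of the deterministic skeleton: `c₁` and `c₀` bound the Lyapunov function after
a received and an erased packet. -/
theorem zoom_drift_in_view {p α G M qm Δ L W c₁ c₀ lam : ℝ} (hp0 : 0 < p) (hp1 : p < 1)
    (hM : 0 ≤ M) (hlam : 0 ≤ lam)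
    (hcontr : (p * α ^ 2 + (1 - p) * G ^ 2) * (1 + M * qm) ≤ lam)
    (hW : Δ ^ 2 ≤ W)
    (hc₁ : c₁ ≤ α ^ 2 * Δ ^ 2 * (1 + M * qm) + L ^ 2 * (1 + M))
    (hc₀ : c₀ ≤ G ^ 2 * Δ ^ 2 * (1 + M * qm)) :
    p * c₁ + (1 - p) * c₀ ≤ lam * W + L ^ 2 * (1 + M) := by
  have h1 := mul_le_mul_of_nonneg_left hc₁ hp0.le
  have h0 := mul_le_mul_of_nonneg_left hc₀ (sub_nonneg.2 hp1.le)
  have h2 := mul_le_mul_of_nonneg_right hcontr (sq_nonneg Δ)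
  have h3 := mul_le_mul_of_nonneg_left hW hlam
  have h4 : p * (L ^ 2 * (1 + M)) ≤ L ^ 2 * (1 + M) :=
    mul_le_of_le_one_left (by positivity) hp1.le
  linarith

theorem zoom_drift_out_of_view {p G M qm hm Δ lam c : ℝ} {c₁ c₀ : ℝ}
    (hp0 : 0 < p) (hp1 : p < 1) (hM : M = 4 * G ^ 2) (hhm : 1 ≤ hm)
    (hlam : 1 / 2 ≤ lam) (hqm : G ^ 2 * qm ≤ 1 / 4) (hc : 0 ≤ c)
    (hc₁ : c₁ ≤ G ^ 2 * Δ ^ 2 * (1 + M * (qm * hm)))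
    (hc₀ : c₀ ≤ G ^ 2 * Δ ^ 2 * (1 + M * (qm * hm))) :
    p * c₁ + (1 - p) * c₀ ≤ lam * (Δ ^ 2 * (1 + M * hm)) + c := by
  have h1 := mul_le_mul_of_nonneg_left hc₁ hp0.le
  have h0 := mul_le_mul_of_nonneg_left hc₀ (sub_nonneg.2 hp1.le)
  have hM0 : 0 ≤ M := by rw [hM]; positivity
  have hMhm : 0 ≤ M * hm := by positivity
  have h2 : G ^ 2 * (1 + M * (qm * hm)) ≤ lam * (1 + M * hm) := by
    have h3 := mul_le_mul_of_nonneg_right hqm hMhm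
    have h4 : M ≤ M * hm := le_mul_of_one_le_right hM0 hhm
    have h5 := mul_le_mul_of_nonneg_right hlam (show 0 ≤ 1 + M * hm by linarith)
    linarith
  have h6 := mul_le_mul_of_nonneg_right h2 (sq_nonneg Δ)
  linarith

theorem exists_contraction_split {a α G K : ℝ} (ha : 1 ≤ |a|) (hK : 0 < K) (hα : 0 < α)
    (hαa : |a| / K < α) (hG : |a| < G) :
    ∃ θ q : ℝ, 0 < θ ∧ θ < 1 ∧ 0 ≤ q ∧ q < 1 ∧ |a| ≤ θ * q * (K * α) ∧ |a| ≤ θ * q * G := by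
  have hG0 : 0 < G := by linarith
  set ρ := max (|a| / (K * α)) (|a| / G) with hρ
  have hρ0 : 0 ≤ ρ := le_max_of_le_left (by positivity)
  have hρ1 : ρ < 1 := by
    refine max_lt ?_ ?_
    · rw [div_lt_one (by positivity)]
      rwa [div_lt_iff₀ hK, mul_comm] at hαa
    · rwa [div_lt_one hG0]
  have hθ : (0 : ℝ) < (1 + ρ) / 2 := by linarith
  refine ⟨(1 + ρ) / 2, ρ / ((1 + ρ) / 2), hθ, by linarith, by positivity, ?_, ?_, ?_⟩
  · rw [div_lt_one hθ]; linarith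
  · rw [mul_div_cancel₀ _ hθ.ne', ← div_le_iff₀ (by positivity)]
    exact le_max_left _ _
  · rw [mul_div_cancel₀ _ hθ.ne', ← div_le_iff₀ hG0]
    exact le_max_right _ _

/-- The expectation of an affine-plus-noise bound under the Bernoulli mixture of two Gaussian
laws. -/
theorem lintegral_mixture_le {p c₁ c₀ : ℝ} (hp0 : 0 < p) (hp1 : p < 1) (hc₁ : 0 ≤ c₁)
    (hc₀ : 0 ≤ c₀) (μ : Measure ℝ) [IsProbabilityMeasure μ] {g : ℝ → ℝ} (hg : ∀ d, 0 ≤ g d)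
    {f₁ f₀ : ℝ → ℝ} (h₁ : ∀ d, f₁ d ≤ c₁ + g d) (h₀ : ∀ d, f₀ d ≤ c₀ + g d) :
    ENNReal.ofReal p * ∫⁻ d, ENNReal.ofReal (f₁ d) ∂μ
        + ENNReal.ofReal (1 - p) * ∫⁻ d, ENNReal.ofReal (f₀ d) ∂μ
      ≤ ENNReal.ofReal (p * c₁ + (1 - p) * c₀) + ∫⁻ d, ENNReal.ofReal (g d) ∂μ := by
  have key : ∀ {c : ℝ} {f : ℝ → ℝ}, 0 ≤ c → (∀ d, f d ≤ c + g d) →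
      ∫⁻ d, ENNReal.ofReal (f d) ∂μ ≤ ENNReal.ofReal c + ∫⁻ d, ENNReal.ofReal (g d) ∂μ := by
    intro c f hc hf
    calc ∫⁻ d, ENNReal.ofReal (f d) ∂μ
        ≤ ∫⁻ d, (ENNReal.ofReal c + ENNReal.ofReal (g d)) ∂μ := by
          refine lintegral_mono fun d => ?_
          rw [← ENNReal.ofReal_add hc (hg d)]
          exact ENNReal.ofReal_le_ofReal (hf d)
      _ = _ := by
          rw [lintegral_add_left measurable_const]
          simp
  have h1p : 0 ≤ 1 - p := by linarith
  set N := ∫⁻ d, ENNReal.ofReal (g d) ∂μ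
  calc _ ≤ ENNReal.ofReal p * (ENNReal.ofReal c₁ + N)
        + ENNReal.ofReal (1 - p) * (ENNReal.ofReal c₀ + N) := by
        gcongr
        · exact key hc₁ h₁
        · exact key hc₀ h₀
    _ = (ENNReal.ofReal p * ENNReal.ofReal c₁ + ENNReal.ofReal (1 - p) * ENNReal.ofReal c₀)
        + (ENNReal.ofReal p + ENNReal.ofReal (1 - p)) * N := by ring
    _ = _ := by
        rw [← ENNReal.ofReal_mul hp0.le, ← ENNReal.ofReal_mul h1p,
          ← ENNReal.ofReal_add (by positivity) (by positivity),
          ← ENNReal.ofReal_add hp0.le h1p]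
        simp

/-- One step of the chain, with `θ` splitting the noise from the contraction `q` of the normalised
state: `c₁` bounds the Lyapunov function, up to noise, after a received packet. -/
theorem exists_zoomLyapunov_drift {a α δ L p θ q M lam x Δ : ℝ} {K m : ℕ} (hK : 2 ≤ (K : ℝ))
    (hα0 : 0 < α) (hα1 : α < 1) (hL' : 1 ≤ α * L) (hδ : 0 < |a| + δ) (hp0 : 0 < p) (hp1 : p < 1)
    (hθ0 : 0 < θ) (hθ1 : θ < 1) (hq0 : 0 ≤ q) (hq1 : q ≤ 1) (hm2 : 2 ≤ m) (hM : M = 4 * (|a| + δ) ^ 2)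
    (haα : |a| ≤ θ * q * (K * α)) (hlam : 1 / 2 ≤ lam)
    (hcontr : (p * α ^ 2 + (1 - p) * (|a| + δ) ^ 2) * (1 + M * q ^ m) ≤ lam)
    (hGqm : (|a| + δ) ^ 2 * q ^ m ≤ 1 / 4) (hΔ1 : 1 ≤ Δ)
    (hzoom : ∀ d, zoomLyapunov ((K : ℝ) / 2) M m (a * x + d) (Δ * (|a| + δ))
      ≤ (Δ * (|a| + δ)) ^ 2 * (1 + M * (q * (|x| / ((K : ℝ) / 2 * Δ))) ^ m)
        + M * (|d| / (1 - θ)) ^ m) :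
    ∃ c₁, 0 ≤ c₁ ∧
      (∀ d, zoomLyapunov ((K : ℝ) / 2) M m (a * (x - Qq K Δ x) + d)
          (Δ * Hf a δ α L Δ (x / ((K : ℝ) / 2 * Δ)) true) ≤ c₁ + M * (|d| / (1 - θ)) ^ m) ∧
      p * c₁ + (1 - p)
          * ((Δ * (|a| + δ)) ^ 2 * (1 + M * (q * (|x| / ((K : ℝ) / 2 * Δ))) ^ m))
        ≤ lam * zoomLyapunov ((K : ℝ) / 2) M m x Δ + L ^ 2 * (1 + M) := by
  set G := |a| + δ with hG
  set c : ℝ := (K : ℝ) / 2 with hcdef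
  have hc : 1 ≤ c := by rw [hcdef]; linarith
  have hΔ0 : 0 < Δ := by linarith
  have hcΔ : 0 < c * Δ := by positivity
  have hM0 : 0 ≤ M := by rw [hM]; positivity
  have hqm0 : 0 ≤ q ^ m := by positivity
  have hqm1 : q ^ m ≤ 1 := pow_le_one₀ hq0 hq1
  set h := |x| / (c * Δ) with hh
  have hh0 : 0 ≤ h := by positivity
  have hxh : |x| = h * (c * Δ) := by rw [hh]; field_simp
  have habs : |x / (c * Δ)| = h := by rw [abs_div, abs_of_pos hcΔ]
  set Δ₁ := Δ * Hf a δ α L Δ (x / (c * Δ)) true with hΔ₁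
  rcases le_or_gt h 1 with hle | hgt
  · have hview : |x| ≤ c * Δ := by rw [hxh]; nlinarith
    have hQ := abs_sub_Qq_le hΔ0 hview
    have hsmall : Δ₁ = Δ * α ∧ L ≤ Δ ∨ Δ₁ = Δ ∧ Δ < L := by
      rcases le_or_gt L Δ with hL | hL
      · simp [hΔ₁, Hf, habs, hle.not_gt, hL]
      · simp [hΔ₁, Hf, habs, hle.not_gt, hL, hL.not_ge]
    have hΔ₁1 : 1 ≤ Δ₁ := by
      rcases hsmall with ⟨he, hL⟩ | ⟨he, -⟩
      · rw [he]; nlinarith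
      · rwa [he]
    have hΔ₁α : Δ * α ≤ Δ₁ := by
      rcases hsmall with ⟨he, -⟩ | ⟨he, -⟩ <;> rw [he]
      exact mul_le_of_le_one_right hΔ0.le hα1.le
    have hMqm : 0 ≤ 1 + M * q ^ m := by positivity
    refine ⟨Δ₁ ^ 2 * (1 + M * (q * 1) ^ m), by positivity, fun d => ?_, ?_⟩
    · refine zoomLyapunov_add_le hm2 hc hM0 hθ0 hθ1 hq0 zero_le_one hΔ₁1 ?_
      rw [abs_mul]
      calc |a| * |x - Qq K Δ x| ≤ θ * q * (K * α) * (Δ / 2) := by gcongr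
        _ = θ * q * (c * (Δ * α)) := by rw [hcdef]; ring
        _ ≤ θ * q * (c * Δ₁) := by gcongr
        _ = _ := by ring
    · refine zoom_drift_in_view hp0 hp1 hM0 (by linarith) hcontr
        (W := zoomLyapunov c M m x Δ) (Δ := Δ) ?_ ?_ ?_
      · unfold zoomLyapunov
        exact le_mul_of_one_le_right (by positivity) (by
          have : 0 ≤ M * (|x| / (c * Δ)) ^ m := by positivity
          linarith)
      · rw [mul_one]
        rcases hsmall with ⟨he, -⟩ | ⟨he, hL⟩ <;> rw [he]
        · have h1 : 0 ≤ L ^ 2 * (1 + M) := by positivity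
          linarith
        · have h1 : Δ ^ 2 * (1 + M * q ^ m) ≤ L ^ 2 * (1 + M * 1) := by gcongr
          have h2 : 0 ≤ α ^ 2 * Δ ^ 2 * (1 + M * q ^ m) := by positivity
          linarith
      · rw [mul_pow, mul_comm (Δ ^ 2)]
        have : (q * h) ^ m ≤ q ^ m := by
          gcongr
          exact mul_le_of_le_one_right hq0 hle
        gcongr
  · have hout : c * Δ < |x| := by rw [hxh]; nlinarith
    have hΔ₁G : Δ₁ = Δ * G := by simp [hΔ₁, Hf, habs, hgt, hG]
    rw [Qq_eq_zero hΔ0.le hout, sub_zero, hΔ₁G]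
    have he : (Δ * G) ^ 2 * (1 + M * (q * h) ^ m)
        ≤ G ^ 2 * Δ ^ 2 * (1 + M * (q ^ m * h ^ m)) := le_of_eq (by ring)
    refine ⟨_, by positivity, hzoom, ?_⟩
    exact zoom_drift_out_of_view hp0 hp1 hM (one_le_pow₀ hgt.le) hlam hGqm
      (by positivity) he he

/-- Under the additional second-moment rate conditions, every
invariant probability measure of the kernel of `(x_t, Δ_t)` on `ℝ × D` has a finite
second moment in the first coordinate: `∫ x² dπ < ∞`. -/
theorem stmt_19
    (a : ℝ) (K : ℕ) (α δ L p s : ℝ) (σ2 : NNReal)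
    (ha : 1 ≤ |a|) (hK : 2 ≤ K) (hKeven : Even K)
    (hα0 : 0 < α) (hα1 : α < 1) (hαa : |a| / (K : ℝ) < α)
    (hδ0 : 0 < δ) (hL0 : 0 < L) (hL' : 1 ≤ α * L)
    (hp0 : 0 < p) (hp1 : p < 1) (hσ : 0 < σ2) (hs : 0 < s)
    -- `Ã = −log₂(α)/s` and `B̃ = log₂(|a|+δ)/s` are positive coprime integers:
    (hAB : ∃ A B : ℕ, 0 < A ∧ 0 < B ∧ Nat.Coprime A B ∧
      Real.logb 2 α = -(A : ℝ) * s ∧ Real.logb 2 (|a| + δ) = (B : ℝ) * s)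
    -- the recurrence condition `α (|a|+δ)^{1/p − 1} < 1`:
    (hrate : α * (|a| + δ) ^ ((1 : ℝ) / p - 1) < 1)
    (P : ProbabilityTheory.Kernel (ℝ × ↥(Dset α L s)) (ℝ × ↥(Dset α L s)))
    [IsMarkovKernel P]
    -- `P((x,Δ),·)` is the law of `(a(x − Υ·Q_K^Δ(x)) + d, Δ·H(Δ,|h|,Υ))` with
    -- `d ~ N(0,σ²)` and `Υ ~ Bernoulli(p)` independent (identified through the
    -- embedding of `ℝ × D` into `ℝ × ℝ`):
    (hP : ∀ z : ℝ × ↥(Dset α L s),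
      (P z).map (fun w : ℝ × ↥(Dset α L s) => (w.1, (w.2 : ℝ)))
        = ENNReal.ofReal p •
            ((gaussianReal 0 σ2).map (fun u : ℝ =>
              (a * (z.1 - Qq K (z.2 : ℝ) z.1) + u,
               (z.2 : ℝ) * Hf a δ α L (z.2 : ℝ)
                 (z.1 / ((K : ℝ) / 2 * (z.2 : ℝ))) true)))
          + ENNReal.ofReal (1 - p) •
            ((gaussianReal 0 σ2).map (fun u : ℝ =>
              (a * z.1 + u,
               (z.2 : ℝ) * Hf a δ α L (z.2 : ℝ)
                 (z.1 / ((K : ℝ) / 2 * (z.2 : ℝ))) false)))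
    )
    (hsec : a ^ 2 * (1 - p + p / (K : ℝ) ^ 2) < 1)
    (hsq : (1 - p) * (|a| + δ) ^ 2 < 1)
    (hsec2 : p * α ^ 2 / (1 - (1 - p) * (|a| + δ) ^ 2) < 1) :
    ∀ π : Measure (ℝ × ↥(Dset α L s)), IsProbabilityMeasure π →
      (∀ A : Set (ℝ × ↥(Dset α L s)), MeasurableSet A →
        ∫⁻ z, P z A ∂π = π A) →
      ∫⁻ z : ℝ × ↥(Dset α L s), ENNReal.ofReal (z.1 ^ 2) ∂π < ⊤ := by
  intro π _ hπ
  set G := |a| + δ with hG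
  have hG1 : 1 ≤ G := by linarith
  have hKr : (2 : ℝ) ≤ K := by exact_mod_cast hK
  set c : ℝ := (K : ℝ) / 2 with hcdef
  have hc : 1 ≤ c := by rw [hcdef]; linarith
  obtain ⟨θ, q, hθ0, hθ1, hq0, hq1, haα, haG⟩ :=
    exists_contraction_split ha (by linarith) hα0 hαa (show |a| < G by linarith)
  set lam₀ := p * α ^ 2 + (1 - p) * G ^ 2 with hlam₀
  have h1p : 0 < 1 - p := by linarith
  have hlam₀0 : 0 ≤ lam₀ := by positivity
  have hlam₀1 : lam₀ < 1 := by
    rw [div_lt_one (by linarith)] at hsec2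
    linarith
  set M := 4 * G ^ 2 with hM
  have hM1 : 1 ≤ M := by nlinarith
  obtain ⟨m, hm2, hqm⟩ : ∃ m : ℕ, 2 ≤ m ∧ q ^ m < (1 - lam₀) / (2 * M) := by
    obtain ⟨n, hn⟩ := exists_pow_lt_of_lt_one
      (show 0 < (1 - lam₀) / (2 * M) by have := sub_pos.2 hlam₀1; positivity) hq1
    exact ⟨n + 2, by omega, (pow_le_pow_of_le_one hq0 hq1.le (by omega)).trans_lt hn⟩
  rw [lt_div_iff₀ (by positivity)] at hqm
  have hqm0 : 0 ≤ q ^ m := by positivity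
  set lam := (1 + lam₀) / 2 with hlam
  have hlam2 : 1 / 2 ≤ lam := by rw [hlam]; linarith
  have hlam0 : 0 ≤ lam := le_trans (by norm_num) hlam2
  have hlam1 : lam < 1 := by rw [hlam]; linarith
  have hcontr : lam₀ * (1 + M * q ^ m) ≤ lam := by
    have h : lam₀ * (M * q ^ m) ≤ M * q ^ m :=
      mul_le_of_le_one_left (by positivity) hlam₀1.le
    linarith
  have hGqm : G ^ 2 * q ^ m ≤ 1 / 4 := by
    have h : 8 * (G ^ 2 * q ^ m) < 1 - lam₀ := by rw [hM] at hqm; linarith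
    linarith
  have hLL : 0 ≤ L ^ 2 * (1 + M) := by positivity
  have hnoise : ∀ d : ℝ, 0 ≤ M * (|d| / (1 - θ)) ^ m := fun d => by
    have := sub_pos.2 hθ1
    positivity
  have hDpos : ∀ Δ : ↥(Dset α L s), 1 ≤ (Δ : ℝ) := fun Δ => hL'.trans Δ.2.1
  set V : ℝ × ↥(Dset α L s) → ℝ≥0∞ :=
    fun w => ENNReal.ofReal (zoomLyapunov c M m w.1 w.2) with hVdef
  have hemb : Measurable fun w : ℝ × ↥(Dset α L s) => (w.1, (w.2 : ℝ)) := by fun_prop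
  have hV₀ : Measurable fun w : ℝ × ℝ => ENNReal.ofReal (zoomLyapunov c M m w.1 w.2) :=
    (measurable_zoomLyapunov c M m).ennreal_ofReal
  have hV : Measurable V := hV₀.comp hemb
  have hdrift : ∀ z, ∫⁻ w, V w ∂(P z) ≤ ENNReal.ofReal lam * V z
      + (ENNReal.ofReal (L ^ 2 * (1 + M))
        + ∫⁻ d, ENNReal.ofReal (M * (|d| / (1 - θ)) ^ m) ∂(gaussianReal 0 σ2)) := by
    rintro ⟨x, Δ, hΔD⟩
    have hΔ1 : 1 ≤ Δ := hDpos ⟨Δ, hΔD⟩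
    have hΔ0 : 0 < Δ := zero_lt_one.trans_le hΔ1
    have hcΔ : 0 < c * Δ := by positivity
    have hVz : 0 ≤ zoomLyapunov c M m x Δ := by unfold zoomLyapunov; positivity
    set h := |x| / (c * Δ) with hh
    have hh0 : 0 ≤ h := by positivity
    have hxh : |x| = h * (c * Δ) := by rw [hh]; field_simp
    have hz := hP ⟨x, Δ, hΔD⟩
    simp only at hz
    set Δ₁ := Δ * Hf a δ α L Δ (x / (c * Δ)) true with hΔ₁
    have hΔ₀ : Δ * Hf a δ α L Δ (x / (c * Δ)) false = Δ * G := by simp [Hf, hG]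
    rw [hΔ₀] at hz
    have hint : ∫⁻ w, V w ∂(P (x, ⟨Δ, hΔD⟩))
        = ENNReal.ofReal p * ∫⁻ d, ENNReal.ofReal
            (zoomLyapunov c M m (a * (x - Qq K Δ x) + d) Δ₁) ∂(gaussianReal 0 σ2)
          + ENNReal.ofReal (1 - p) * ∫⁻ d, ENNReal.ofReal
            (zoomLyapunov c M m (a * x + d) (Δ * G)) ∂(gaussianReal 0 σ2) := by
      rw [hVdef, ← lintegral_map hV₀ hemb, hz, lintegral_add_measure, lintegral_smul_measure,
        lintegral_smul_measure, lintegral_map hV₀ (by fun_prop), lintegral_map hV₀ (by fun_prop)]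
      rfl
    have hΔG1 : 1 ≤ Δ * G := one_le_mul_of_one_le_of_one_le hΔ1 hG1
    have hzoom : ∀ d, zoomLyapunov c M m (a * x + d) (Δ * G)
        ≤ (Δ * G) ^ 2 * (1 + M * (q * h) ^ m) + M * (|d| / (1 - θ)) ^ m := fun d => by
      refine zoomLyapunov_add_le hm2 hc (zero_le_one.trans hM1) hθ0 hθ1 hq0 hh0 hΔG1 ?_
      rw [abs_mul, hxh]
      calc |a| * (h * (c * Δ)) ≤ θ * q * G * (h * (c * Δ)) := by gcongr
        _ = _ := by ring
    obtain ⟨c₁, hc₁, hb₁, hle⟩ := exists_zoomLyapunov_drift hKr hα0 hα1 hL' (zero_lt_one.trans_le hG1) hp0 hp1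
      hθ0 hθ1 hq0 hq1.le hm2 hM haα hlam2 hcontr hGqm hΔ1 hzoom
    rw [hint]
    refine (lintegral_mixture_le hp0 hp1 hc₁ (by positivity) _ hnoise hb₁ hzoom).trans ?_
    rw [← add_assoc]
    gcongr
    rw [hVdef, ← ENNReal.ofReal_mul hlam0, ← ENNReal.ofReal_add (by positivity) hLL]
    exact ENNReal.ofReal_le_ofReal hle
  have hVfin := lintegral_lt_top_of_geometric_drift P π hπ hV (fun _ => ENNReal.ofReal_ne_top)
    (ENNReal.ofReal_lt_one.2 hlam1)
    (ENNReal.add_ne_top.2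
      ⟨ENNReal.ofReal_ne_top, lintegral_abs_pow_gaussianReal_ne_top 0 σ2 M (1 - θ) m⟩) hdrift
  calc ∫⁻ z : ℝ × ↥(Dset α L s), ENNReal.ofReal (z.1 ^ 2) ∂π
      ≤ ∫⁻ z, ENNReal.ofReal (c ^ 2) * V z ∂π := by
        refine lintegral_mono fun z => ?_
        rw [hVdef, ← ENNReal.ofReal_mul (by positivity)]
        exact ENNReal.ofReal_le_ofReal
          (sq_le_zoomLyapunov hm2 (zero_lt_one.trans_le hc) hM1
            (zero_lt_one.trans_le (hDpos z.2)))
    _ = ENNReal.ofReal (c ^ 2) * ∫⁻ z, V z ∂π := lintegral_const_mul _ hV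
    _ < ⊤ := ENNReal.mul_lt_top ENNReal.ofReal_lt_top hVfin
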